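/- Let R : Fin n → Fin n → Prop be elementary, let x be an upper node of degree k, and let P := {v : Fin n | v ≠ x ∧ v has upper degree 2 ∧ every j with R v j also satisfies R x j} (the set of upper nodes having x as a partner). Assume P is nonempty. Then |P| + 1 ≤ k. Moreover, if |P| + 1 = k, then the support of the connected component of Sum.inl x in G_R equals {Sum.inl x} ∪ {Sum.inl v | v ∈ P} ∪ {Sum.inr j | R x j}; in particular x together with the nodes it is partner for forms the entire upper layer of a connected component of G_R. -/

import Mathlib

/-- The permutation matrix of `σ`: entry 1 at `(i, σ i)` and 0 elsewhere. -/
def permMat {n : ℕ} (σ : Equiv.Perm (Fin n)) : Matrix (Fin n) (Fin n) ℝ :=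
  fun i j => if σ i = j then 1 else 0

/-- `σ` is a (perfect) matching of the bipartite graph of `R`. -/
def IsMatching {n : ℕ} (R : Fin n → Fin n → Prop) (σ : Equiv.Perm (Fin n)) : Prop :=
  ∀ i, R i (σ i)

/-- `R` is elementary (a face graph): every edge lies in some matching. -/
def IsElementary {n : ℕ} (R : Fin n → Fin n → Prop) : Prop :=
  ∀ i j, R i j → ∃ σ : Equiv.Perm (Fin n), IsMatching R σ ∧ σ i = j

/-- The face of the Birkhoff polytope corresponding to `R`. -/
def face {n : ℕ} (R : Fin n → Fin n → Prop) : Set (Matrix (Fin n) (Fin n) ℝ) :=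
  convexHull ℝ {M | ∃ σ : Equiv.Perm (Fin n), IsMatching R σ ∧ M = permMat σ}

/-- The bipartite simple graph `G_R` on `Fin n ⊕ Fin n`, where `Sum.inl i` and
`Sum.inr j` are adjacent iff `R i j`. -/
def graphOf {n : ℕ} (R : Fin n → Fin n → Prop) : SimpleGraph (Fin n ⊕ Fin n) :=
  SimpleGraph.fromRel (fun a b => ∃ i j, a = Sum.inl i ∧ b = Sum.inr j ∧ R i j)

/-- The degree of the upper node `i`. -/
def upDeg {n : ℕ} (R : Fin n → Fin n → Prop) [∀ i j, Decidable (R i j)] (i : Fin n) : ℕ :=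
  Fintype.card {j // R i j}

/-- The degree of the lower node `j`. -/
def loDeg {n : ℕ} (R : Fin n → Fin n → Prop) [∀ i j, Decidable (R i j)] (j : Fin n) : ℕ :=
  Fintype.card {i // R i j}

/-- The number of edges of the bipartite graph of `R`. -/
def edgeCount {n : ℕ} (R : Fin n → Fin n → Prop) [∀ i j, Decidable (R i j)] : ℕ :=
  Fintype.card {p : Fin n × Fin n // R p.1 p.2}

/-- An upper node `v` of degree 2 with neighbors `w₁ ≠ w₂` is reducible if no `u ≠ v`
is adjacent to both `w₁` and `w₂`. -/
def UpperReducible {n : ℕ} (R : Fin n → Fin n → Prop) (v : Fin n) : Prop :=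
  ∃ w₁ w₂ : Fin n, w₁ ≠ w₂ ∧ R v w₁ ∧ R v w₂ ∧ (∀ j, R v j → j = w₁ ∨ j = w₂) ∧
    ¬ ∃ u, u ≠ v ∧ R u w₁ ∧ R u w₂

/-- Reducibility of lower nodes, defined symmetrically. -/
def LowerReducible {n : ℕ} (R : Fin n → Fin n → Prop) (v : Fin n) : Prop :=
  UpperReducible (fun i j => R j i) v

/-- `R` is irreducible if none of its nodes is reducible. -/
def IrreducibleRel {n : ℕ} (R : Fin n → Fin n → Prop) : Prop :=
  (∀ v, ¬ UpperReducible R v) ∧ (∀ v, ¬ LowerReducible R v)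

/-- The face poset of a set `P`: the collection of its faces (convex extreme subsets),
ordered by inclusion. -/
def facesOf {E : Type*} [AddCommGroup E] [Module ℝ E] (P : Set E) : Set (Set E) :=
  {F | Convex ℝ F ∧ IsExtreme ℝ P F}

theorem graphOf_adj_inl_inr {n : ℕ} {R : Fin n → Fin n → Prop} {i j : Fin n} :
    (graphOf R).Adj (Sum.inl i) (Sum.inr j) ↔ R i j := by
  simp [graphOf]

theorem graphOf_adj_iff {n : ℕ} {R : Fin n → Fin n → Prop} {a b : Fin n ⊕ Fin n} :
    (graphOf R).Adj a b ↔
      ∃ i j, R i j ∧ (a = Sum.inl i ∧ b = Sum.inr j ∨ a = Sum.inr j ∧ b = Sum.inl i) := by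
  rcases a with a | a <;> rcases b with b | b <;> simp [graphOf]

/-- A set of vertices that is closed under adjacency is closed under reachability. -/
theorem SimpleGraph.Reachable.mem_of_adj_closed {V : Type*} {G : SimpleGraph V} {S : Set V}
    (hS : ∀ a b, G.Adj a b → a ∈ S → b ∈ S) {a b : V} (h : G.Reachable a b) (ha : a ∈ S) :
    b ∈ S := by
  obtain ⟨p⟩ := h
  induction p with
  | nil => exact ha
  | cons hadj _ ih => exact ih (hS _ _ hadj ha)

/-- If a matching maps `U` into `N`, then `U` has at most as many elements as `N`. -/
theorem IsMatching.ncard_le {n : ℕ} {R : Fin n → Fin n → Prop} {σ : Equiv.Perm (Fin n)}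
    (hσ : IsMatching R σ) {U N : Set (Fin n)} (h : ∀ i ∈ U, ∀ j, R i j → j ∈ N) :
    U.ncard ≤ N.ncard :=
  Set.ncard_le_ncard_of_injOn σ (fun i hi => h i hi _ (hσ i)) σ.injective.injOn N.toFinite

/-- If all neighbors of `U` lie in `N` and `U` and `N` have equal size, then in an elementary
relation all neighbors of `N` lie in `U`. -/
theorem IsElementary.mem_of_ncard_eq {n : ℕ} {R : Fin n → Fin n → Prop} (hR : IsElementary R)
    {U N : Set (Fin n)} (h : ∀ i ∈ U, ∀ j, R i j → j ∈ N) (hcard : U.ncard = N.ncard)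
    {i j : Fin n} (hij : R i j) (hj : j ∈ N) : i ∈ U := by
  obtain ⟨σ, hσ, rfl⟩ := hR i j hij
  have himage : σ '' U = N := by
    refine Set.eq_of_subset_of_ncard_le ?_ ?_ N.toFinite
    · rintro _ ⟨u, hu, rfl⟩
      exact h u hu _ (hσ u)
    · rw [Set.ncard_image_of_injective U σ.injective, hcard]
  rw [← himage] at hj
  exact σ.injective.mem_set_image.mp hj

/-- A partner `x` of degree `k` is partner for at most `k - 1` nodes; in case of
equality, `x` and the nodes it is partner for form the entire upper layer of a
connected component of `G_R`. -/
theorem stmt5 (n : ℕ) (R : Fin n → Fin n → Prop) [∀ i j, Decidable (R i j)]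
    (hel : IsElementary R) (x : Fin n) (k : ℕ) (hk : upDeg R x = k)
    (P : Set (Fin n))
    (hP : P = {v : Fin n | v ≠ x ∧ upDeg R v = 2 ∧ ∀ j, R v j → R x j})
    (hPne : P.Nonempty) :
    Nat.card P + 1 ≤ k ∧
    (Nat.card P + 1 = k →
      ((graphOf R).connectedComponentMk (Sum.inl x)).supp
        = {Sum.inl x} ∪ (Sum.inl '' P) ∪ (Sum.inr '' {j : Fin n | R x j})) := by
  have hxP : x ∉ P := by simp [hP]
  have hU : ∀ i ∈ insert x P, ∀ j, R i j → j ∈ {j | R x j} := by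
    rintro i (rfl | hi) j hij
    · exact hij
    · rw [hP] at hi
      exact hi.2.2 j hij
  have hcardU : (insert x P).ncard = Nat.card P + 1 :=
    Set.ncard_insert_of_notMem hxP P.toFinite
  have hcardN : {j | R x j}.ncard = k := by
    rw [← hk, upDeg, ← Nat.card_eq_fintype_card]
    rfl
  have hnbr : ∀ v ∈ P, ∃ j, R v j := by
    intro v hv
    rw [hP] at hv
    have hpos : 0 < upDeg R v := by rw [hv.2.1]; exact two_pos
    obtain ⟨j, hj⟩ := Fintype.card_pos_iff.mp hpos
    exact ⟨j, hj⟩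
  constructor
  · obtain ⟨v, hv⟩ := hPne
    obtain ⟨j, hj⟩ := hnbr v hv
    obtain ⟨σ, hσ, -⟩ := hel v j hj
    rw [← hcardU, ← hcardN]
    exact hσ.ncard_le hU
  · intro hk'
    have hN : ∀ i j, R i j → R x j → i ∈ insert x P := fun i j hij hj =>
      hel.mem_of_ncard_eq hU (by rw [hcardU, hcardN, hk']) hij hj
    ext b
    rw [SimpleGraph.ConnectedComponent.mem_supp_iff, SimpleGraph.ConnectedComponent.eq]
    constructor
    · intro h
      refine h.symm.mem_of_adj_closed ?_ (by simp)
      intro a c hac ha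
      obtain ⟨i, j, hij, ⟨rfl, rfl⟩ | ⟨rfl, rfl⟩⟩ := graphOf_adj_iff.mp hac
      · simpa using hU i (by simpa using ha) j hij
      · simpa using hN i j hij (by simpa using ha)
    · rintro ((rfl | ⟨v, hv, rfl⟩) | ⟨j, hj, rfl⟩)
      · rfl
      · obtain ⟨j, hj⟩ := hnbr v hv
        exact (graphOf_adj_inl_inr.mpr hj).reachable.trans
          (graphOf_adj_inl_inr.mpr (hU v (Or.inr hv) j hj)).symm.reachable
      · exact (graphOf_adj_inl_inr.mpr hj).symm.reachable
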